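/- Let G be a connected graph on n vertices and m edges with diameter 2, and suppose G has exactly k vertices of degree n-1. Then ρ(ε(G)) ≥ (2(n²-n-2m) + k(2n-k-1))/n. -/

import Mathlib

open Finset SimpleGraph

variable {V : Type*}

/-- The eccentricity of a vertex: the largest distance to another vertex. -/
noncomputable def ecc [Fintype V] (G : SimpleGraph V) (u : V) : ℕ :=
  Finset.univ.sup fun v => G.dist u v

/-- The diameter of a graph: the largest eccentricity. -/
noncomputable def gdiam [Fintype V] (G : SimpleGraph V) : ℕ :=
  Finset.univ.sup fun u => ecc G u

/-- The eccentricity matrix: keep the distance `d(u,v)` if it equals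
`min (e u) (e v)`, and put `0` otherwise. -/
noncomputable def eccMatrix [Fintype V] (G : SimpleGraph V) : Matrix V V ℝ :=
  Matrix.of fun u v =>
    if G.dist u v = min (ecc G u) (ecc G v) then (G.dist u v : ℝ) else 0

/-- The distance matrix of a graph. -/
noncomputable def distMatrix [Fintype V] (G : SimpleGraph V) : Matrix V V ℝ :=
  Matrix.of fun u v => (G.dist u v : ℝ)

/-- The Rayleigh quotient of a real symmetric matrix at any vector is at most its largest
eigenvalue. -/
theorem Matrix.IsHermitian.dotProduct_mulVec_le_iSup_eigenvalues [Fintype V] [DecidableEq V]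
    {A : Matrix V V ℝ} (hA : A.IsHermitian) (x : V → ℝ) :
    x ⬝ᵥ (A.mulVec x) ≤ (⨆ i, hA.eigenvalues i) * (x ⬝ᵥ x) := by
  set M := ⨆ i, hA.eigenvalues i
  have hB : (algebraMap ℝ (Matrix V V ℝ) M - A).IsHermitian := by
    refine Matrix.IsHermitian.sub ?_ hA
    ext i j
    simp [Matrix.algebraMap_matrix_apply, eq_comm]
  have hpsd : (algebraMap ℝ (Matrix V V ℝ) M - A).PosSemidef := by
    rw [hB.posSemidef_iff_eigenvalues_nonneg]
    intro i
    have hi := hB.eigenvalues_mem_spectrum_real i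
    rw [← spectrum.singleton_sub_eq, Set.singleton_sub, hA.spectrum_real_eq_range_eigenvalues] at hi
    obtain ⟨_, ⟨j, rfl⟩, hj⟩ := hi
    have : hA.eigenvalues j ≤ M := le_ciSup (Finite.bddAbove_range hA.eigenvalues) j
    simp only [Pi.zero_apply, ← hj]
    linarith
  have h := hpsd.re_dotProduct_nonneg x
  simpa [Matrix.sub_mulVec, dotProduct_sub, Algebra.algebraMap_eq_smul_one, Matrix.smul_mulVec]
    using h

theorem dist_le_ecc [Fintype V] (G : SimpleGraph V) (u v : V) : G.dist u v ≤ ecc G u :=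
  Finset.le_sup (f := fun v => G.dist u v) (mem_univ v)

theorem ecc_le_gdiam [Fintype V] (G : SimpleGraph V) (u : V) : ecc G u ≤ gdiam G :=
  Finset.le_sup (f := fun u => ecc G u) (mem_univ u)

/-- In diameter two, a vertex has eccentricity `1` if it is universal, and `2` otherwise. -/
theorem ecc_eq_of_diam_two [Fintype V] {G : SimpleGraph V} (hG : G.Connected)
    (hd : gdiam G = 2) (v : V) [Decidable (G.IsUniversal v)] :
    ecc G v = if G.IsUniversal v then 1 else 2 := by
  split_ifs with h
  · have hle : ecc G v ≤ 1 := Finset.sup_le fun w _ => by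
      by_cases hw : v = w
      · simp [hw]
      · exact (dist_eq_one_iff_adj.2 (h hw)).le
    have : Nontrivial V := by
      by_contra hV
      rw [not_nontrivial_iff_subsingleton] at hV
      have : gdiam G ≤ 0 := Finset.sup_le fun u _ => Finset.sup_le fun w _ => by
        simp [Subsingleton.elim u w]
      omega
    obtain ⟨w, hw⟩ := exists_ne v
    have := dist_le_ecc G v w
    have := dist_eq_one_iff_adj.2 (h hw.symm)
    omega
  · simp only [IsUniversal, not_forall] at h
    obtain ⟨w, hw, hadj⟩ := h
    have := hG.one_lt_dist_of_ne_of_not_adj hw hadj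
    have := dist_le_ecc G v w
    have := ecc_le_gdiam G v
    omega

/-- In diameter two, the entries of the eccentricity matrix in terms of adjacency and of the
indicator function of the universal vertices. -/
theorem eccMatrix_apply_of_diam_two [Fintype V] [DecidableEq V] {G : SimpleGraph V}
    [DecidableRel G.Adj] [DecidablePred G.IsUniversal] (hG : G.Connected) (hd : gdiam G = 2)
    (u v : V) :
    eccMatrix G u v = 2 * (1 - (if u = v then 1 else 0) - (if G.Adj u v then 1 else 0)) +
      (if G.IsUniversal u then 1 else 0) + (if G.IsUniversal v then 1 else 0) -
      (if G.IsUniversal u then 1 else 0) * (if G.IsUniversal v then 1 else 0) -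
      (if u = v then (if G.IsUniversal u then 1 else 0) else 0) := by
  simp only [eccMatrix, Matrix.of_apply, ecc_eq_of_diam_two hG hd]
  by_cases huv : u = v
  · subst huv
    by_cases hu : G.IsUniversal u <;> simp [hu]
  · by_cases hadj : G.Adj u v
    · rw [dist_eq_one_iff_adj.2 hadj]
      by_cases hu : G.IsUniversal u <;> by_cases hv : G.IsUniversal v <;> simp [hu, hv, huv, hadj]
    · have hu : ¬ G.IsUniversal u := fun h => hadj (h huv)
      have hv : ¬ G.IsUniversal v := fun h => hadj (h (Ne.symm huv)).symm
      have := hG.one_lt_dist_of_ne_of_not_adj huv hadj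
      have := dist_le_ecc G u v
      have := ecc_le_gdiam G u
      have hdist : G.dist u v = 2 := by omega
      simp [hu, hv, huv, hadj, hdist]

/-- In diameter two, the sum of all entries of the eccentricity matrix. -/
theorem sum_eccMatrix_of_diam_two [Fintype V] [DecidableEq V] {G : SimpleGraph V}
    [DecidableRel G.Adj] [DecidablePred G.IsUniversal] (hG : G.Connected) (hd : gdiam G = 2) :
    ∑ u, ∑ v, eccMatrix G u v =
      2 * ((Fintype.card V : ℝ) ^ 2 - Fintype.card V - 2 * #G.edgeFinset) +
        #{v | G.IsUniversal v} * (2 * Fintype.card V - #{v | G.IsUniversal v} - 1) := by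
  have hdeg : ∑ u, (G.degree u : ℝ) = 2 * #G.edgeFinset := by
    exact_mod_cast G.sum_degrees_eq_twice_card_edges
  have hadj (u : V) : ∑ v, (if G.Adj u v then 1 else 0 : ℝ) = G.degree u := by
    rw [sum_boole, ← card_neighborFinset_eq_degree, neighborFinset_eq_filter]
  have huniv : ∑ v, (if G.IsUniversal v then 1 else 0 : ℝ) = #{v | G.IsUniversal v} := by
    rw [sum_boole]
  simp only [eccMatrix_apply_of_diam_two hG hd, sum_sub_distrib, sum_add_distrib, ← mul_sum,
    ← sum_mul, hadj, huniv, hdeg, sum_ite_eq, sum_const, card_univ, mem_univ, if_true,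
    nsmul_eq_mul]
  ring

/-- For a connected graph of diameter 2 with `n` vertices, `m` edges
and exactly `k` vertices of degree `n-1`,
`ρ(ε(G)) ≥ (2(n²-n-2m) + k(2n-k-1))/n`. -/
theorem eccMatrix_spectralRadius_ge_of_diam_two [Fintype V] [DecidableEq V]
    (G : SimpleGraph V) [DecidableRel G.Adj] (hG : G.Connected)
    (n m k : ℕ) (hn : Fintype.card V = n) (hm : G.edgeFinset.card = m)
    (hd : gdiam G = 2)
    (hk : (Finset.univ.filter fun v => G.degree v = n - 1).card = k)
    (hE : (eccMatrix G).IsHermitian) :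
    (2 * ((n : ℝ) ^ 2 - n - 2 * m) + k * (2 * n - k - 1)) / (n : ℝ) ≤
      ⨆ i, hE.eigenvalues i := by
  classical
  have : Nonempty V := hG.nonempty
  have hpos : (0 : ℝ) < n := by
    rw [← hn]
    exact_mod_cast Fintype.card_pos
  have hsum := sum_eccMatrix_of_diam_two hG hd
  rw [← hn] at hk
  simp only [degree_eq_card_sub_one] at hk
  rw [hn, hm, hk] at hsum
  have hray := hE.dotProduct_mulVec_le_iSup_eigenvalues 1
  rw [div_le_iff₀ hpos, ← hsum]
  simpa [dotProduct, Matrix.mulVec, hn] using hray
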